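/- For all μ₁, μ₂ ∈ ℕ and 0 ≤ i ≤ min(μ₁,μ₂): S v_i^{μ₁,μ₂} = (−1)^{μ₁−i}·q^{(μ₁−i)(μ₂−i+1)}·v_i^{μ₂,μ₁}. -/

import Mathlib

/-- The variable `q` in the field `ℚ(q)` of rational functions. -/
noncomputable def qq : RatFunc ℚ := RatFunc.X

/-- The quantum integer `[m] = ∑_{s=0}^{m-1} q^{m-1-2s} = (q^m - q^{-m})/(q - q^{-1})`. -/
noncomputable def qint (m : ℕ) : RatFunc ℚ :=
  ∑ s ∈ Finset.range m, qq ^ ((m : ℤ) - 1 - 2 * (s : ℤ))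

/-- The quantum factorial `[m]! = [m][m-1]⋯[1]`. -/
noncomputable def qfact (m : ℕ) : RatFunc ℚ :=
  ∏ r ∈ Finset.range m, qint (r + 1)

/-- The quantum binomial coefficient `[m]!/([a]![m-a]!)`. -/
noncomputable def qbinom (m a : ℕ) : RatFunc ℚ :=
  qfact m / (qfact a * qfact (m - a))

/-- The `ℚ(q)`-vector space with basis `X^m` indexed by the exponent functions
`m : Fin k × Fin 2 → ℕ` (rows `1,…,k` and two columns, 0-indexed). -/
abbrev Mmod (k : ℕ) := (Fin k × Fin 2 → ℕ) →₀ RatFunc ℚ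

/-- The basis vector `X^m` of `Mmod k`. -/
noncomputable def Xb {k : ℕ} (m : Fin k × Fin 2 → ℕ) : Mmod k :=
  Finsupp.single m 1

/-- A linear operator on `Mmod k` defined by its values on the basis `X^m`. -/
noncomputable def mkOp {k : ℕ} (f : (Fin k × Fin 2 → ℕ) → Mmod k) :
    Mmod k →ₗ[RatFunc ℚ] Mmod k :=
  Finsupp.lift (Mmod k) (RatFunc ℚ) (Fin k × Fin 2 → ℕ) f

/-- The exponent function `m + ε_p − ε_{p'}` (with truncated subtraction; in all
formulas below a term whose exponent function fails to be `ℕ`-valued carries a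
vanishing coefficient `[0] = 0`). -/
def shiftExp {k : ℕ} (m : Fin k × Fin 2 → ℕ) (pup pdown : Fin k × Fin 2) :
    Fin k × Fin 2 → ℕ :=
  fun p => m p + (if p = pup then 1 else 0) - (if p = pdown then 1 else 0)

/-- The highest weight vector
`v_i^{μ₁,μ₂} = ∑_{a=0}^{i} (−1)^a qbinom(i,a) q^{a(μ₂−a+1)} X^{m(a)}`, where
`m(a)_{1,1} = μ₁−i+a`, `m(a)_{2,1} = i−a`, `m(a)_{1,2} = μ₂−a`,
`m(a)_{2,2} = a` and `m(a)` vanishes on rows `≥ 3`. -/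
noncomputable def vvec {k : ℕ} (hk : 2 ≤ k) (μ₁ μ₂ i : ℕ) : Mmod k :=
  ∑ a ∈ Finset.range (i + 1),
    ((-1) ^ a * qbinom i a * qq ^ (a * (μ₂ - a + 1))) •
      Xb (fun p =>
        if p = ((⟨0, by omega⟩ : Fin k), (0 : Fin 2)) then μ₁ - i + a
        else if p = ((⟨1, by omega⟩ : Fin k), (0 : Fin 2)) then i - a
        else if p = ((⟨0, by omega⟩ : Fin k), (1 : Fin 2)) then μ₂ - a
        else if p = ((⟨1, by omega⟩ : Fin k), (1 : Fin 2)) then a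
        else 0)

/-- The operator `E` of `U_q(sl₂)` acting columnwise on `Mmod k`:
`E X^m = ∑_i [m_{i,2}] (∏_{i' > i} q^{m_{i',1}−m_{i',2}}) X^{m+ε_{i,1}−ε_{i,2}}`. -/
noncomputable def Eop (k : ℕ) : Mmod k →ₗ[RatFunc ℚ] Mmod k :=
  mkOp fun m =>
    ∑ i : Fin k,
      (qint (m (i, 1)) *
          ∏ i' : Fin k,
            if i < i' then qq ^ ((m (i', 0) : ℤ) - (m (i', 1) : ℤ)) else 1) •
        Xb (shiftExp m (i, 0) (i, 1))

/-- The operator `F` of `U_q(sl₂)` acting columnwise on `Mmod k`: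
`F X^m = ∑_i [m_{i,1}] (∏_{i' < i} q^{−(m_{i',1}−m_{i',2})}) X^{m−ε_{i,1}+ε_{i,2}}`. -/
noncomputable def Fop (k : ℕ) : Mmod k →ₗ[RatFunc ℚ] Mmod k :=
  mkOp fun m =>
    ∑ i : Fin k,
      (qint (m (i, 0)) *
          ∏ i' : Fin k,
            if i' < i then qq ^ (-((m (i', 0) : ℤ) - (m (i', 1) : ℤ))) else 1) •
        Xb (shiftExp m (i, 1) (i, 0))

/-- The operator `H`: `H X^m = (∑_i (m_{i,1} − m_{i,2})) X^m`. -/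
noncomputable def Hop (k : ℕ) : Mmod k →ₗ[RatFunc ℚ] Mmod k :=
  mkOp fun m =>
    (((∑ i : Fin k, ((m (i, 0) : ℤ) - (m (i, 1) : ℤ))) : ℤ) : RatFunc ℚ) • Xb m

/-- The diagonal operator multiplying `X^m` by `q^{f(w)}`, where
`w = ∑_i (m_{i,1} − m_{i,2})`.  Taking `f = id`, `f = -·` and
`f = w ↦ w(w+1)/2` yields `q^H`, `q^{−H}` and `q^{H(H+1)/2}`. -/
noncomputable def qHop (k : ℕ) (f : ℤ → ℤ) : Mmod k →ₗ[RatFunc ℚ] Mmod k :=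
  mkOp fun m => (qq ^ f (∑ i : Fin k, ((m (i, 0) : ℤ) - (m (i, 1) : ℤ)))) • Xb m

/-- The total degree of the exponents occurring in `v`. -/
def tdeg {k : ℕ} (v : Mmod k) : ℕ :=
  v.support.sup fun m => ∑ p : Fin k × Fin 2, m p

/-- `exp_{q^{−1}}(x) v = ∑_{n ≥ 0} q^{−n(n−1)/2} (x^n v)/[n]!`; for the locally
nilpotent operators considered here the sum is finite on each vector, all terms
with `n > tdeg v` vanishing (the operators preserve total degree and shift
column degrees). -/
noncomputable def qexpApp {k : ℕ} (x : Mmod k →ₗ[RatFunc ℚ] Mmod k)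
    (v : Mmod k) : Mmod k :=
  ∑ n ∈ Finset.range (tdeg v + 1),
    (qq ^ (-((n * (n - 1) / 2 : ℕ) : ℤ)) / qfact n) • (x ^ n) v

/-- The quantum Weyl group operator
`S = exp_{q^{−1}}(q^{−1} E q^{−H}) ∘ exp_{q^{−1}}(−F) ∘ exp_{q^{−1}}(q E q^{H}) ∘ q^{H(H+1)/2}`
applied to a vector of `Mmod k`. -/
noncomputable def Sapp (k : ℕ) (v : Mmod k) : Mmod k :=
  qexpApp (qq⁻¹ • (Eop k ∘ₗ qHop k (fun w => -w)))
    (qexpApp (-(Fop k))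
      (qexpApp (qq • (Eop k ∘ₗ qHop k id))
        (qHop k (fun w => w * (w + 1) / 2) v)))

lemma qq_ne_zero : qq ≠ 0 := RatFunc.X_ne_zero

lemma qq_pow_ne_one {m : ℕ} (hm : m ≠ 0) : qq ^ m ≠ 1 := by
  intro h
  have h' : algebraMap (Polynomial ℚ) (RatFunc ℚ) (Polynomial.X ^ m) =
      algebraMap (Polynomial ℚ) (RatFunc ℚ) 1 := by
    rw [map_pow, RatFunc.algebraMap_X, map_one]
    exact h
  have h'' := congrArg Polynomial.natDegree (RatFunc.algebraMap_injective ℚ h')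
  rw [Polynomial.natDegree_X_pow, Polynomial.natDegree_one] at h''
  exact hm h''

lemma qq_sub_inv_ne_zero : qq - qq⁻¹ ≠ 0 := by
  intro h
  apply qq_pow_ne_one (two_ne_zero)
  have := qq_ne_zero
  field_simp at h
  linear_combination h

lemma qint_mul_sub (m : ℕ) : qint m * (qq - qq⁻¹) = qq ^ m - (qq ^ m)⁻¹ := by
  have hq := qq_ne_zero
  have key : ∀ n : ℕ, (∑ s ∈ Finset.range n, qq ^ ((m : ℤ) - 1 - 2 * (s : ℤ))) * (qq - qq⁻¹) =
      qq ^ (m : ℤ) - qq ^ ((m : ℤ) - 2 * n) := by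
    intro n
    induction n with
    | zero => simp
    | succ n ih =>
      rw [Finset.sum_range_succ, add_mul, ih, mul_sub, ← zpow_add_one₀ hq, ← zpow_sub_one₀ hq]
      rw [show (m : ℤ) - 1 - 2 * n + 1 = m - 2 * n by ring,
        show (m : ℤ) - 1 - 2 * n - 1 = m - 2 * (n + 1 : ℕ) by push_cast; ring]
      ring
  rw [qint, key, ← zpow_natCast, ← zpow_neg]
  congr 2
  ring

lemma qint_zero : qint 0 = 0 := by simp [qint]

lemma qint_ne_zero {m : ℕ} (hm : m ≠ 0) : qint m ≠ 0 := by
  intro h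
  have h' := qint_mul_sub m
  have hq := pow_ne_zero m qq_ne_zero
  rw [h, zero_mul] at h'
  apply qq_pow_ne_one (m := m + m) (by omega)
  field_simp at h'
  rw [pow_add]
  linear_combination -h'

lemma qint_add (a b : ℕ) : qint (a + b) = qq ^ b * qint a + (qq ^ a)⁻¹ * qint b := by
  apply mul_right_cancel₀ qq_sub_inv_ne_zero
  have hq := qq_ne_zero
  rw [add_mul, mul_assoc, mul_assoc, qint_mul_sub, qint_mul_sub, qint_mul_sub, pow_add]
  field_simp
  ring

lemma qint_add' (a b : ℕ) : qint (a + b) = (qq ^ b)⁻¹ * qint a + qq ^ a * qint b := by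
  rw [add_comm a b, qint_add b a]
  ring

lemma qfact_succ (m : ℕ) : qfact (m + 1) = qfact m * qint (m + 1) :=
  Finset.prod_range_succ _ _

lemma qfact_ne_zero (m : ℕ) : qfact m ≠ 0 :=
  Finset.prod_ne_zero_iff.2 fun _ _ => qint_ne_zero (Nat.succ_ne_zero _)

/-- The quantum binomial coefficient, extended by zero to `a > m`. -/
noncomputable def gaussBinom (m a : ℕ) : RatFunc ℚ := if a ≤ m then qbinom m a else 0

lemma gaussBinom_of_le {m a : ℕ} (h : a ≤ m) : gaussBinom m a = qbinom m a := if_pos h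

lemma gaussBinom_eq_zero {m a : ℕ} (h : m < a) : gaussBinom m a = 0 := if_neg (by omega)

lemma gaussBinom_add (a d : ℕ) :
    gaussBinom (a + d) a = qfact (a + d) / (qfact a * qfact d) := by
  rw [gaussBinom_of_le (by omega), qbinom, Nat.add_sub_cancel_left]

lemma gaussBinom_zero_right (m : ℕ) : gaussBinom m 0 = 1 := by
  have := gaussBinom_add 0 m
  rw [zero_add] at this
  rw [this, show qfact 0 = 1 by simp [qfact], one_mul, div_self (qfact_ne_zero m)]

lemma gaussBinom_self (m : ℕ) : gaussBinom m m = 1 := by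
  have h := gaussBinom_add m 0
  rwa [show qfact 0 = 1 by simp [qfact], mul_one, add_zero, div_self (qfact_ne_zero m)] at h

lemma gaussBinom_symm {m a : ℕ} (h : a ≤ m) : gaussBinom m (m - a) = gaussBinom m a := by
  obtain ⟨d, rfl⟩ := Nat.exists_eq_add_of_le h
  rw [Nat.add_sub_cancel_left, gaussBinom_add, add_comm a d, gaussBinom_add, mul_comm]

lemma qint_mul_gaussBinom_succ (m a : ℕ) :
    qint (a + 1) * gaussBinom m (a + 1) = qint (m - a) * gaussBinom m a := by
  rcases le_or_gt m a with h | h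
  · rw [gaussBinom_eq_zero (by omega), Nat.sub_eq_zero_of_le h, qint_zero]
    simp
  · obtain ⟨d, rfl⟩ := Nat.exists_eq_add_of_lt h
    have e1 := gaussBinom_add (a + 1) d
    have e2 := gaussBinom_add a (d + 1)
    rw [show a + 1 + d = a + d + 1 by ring] at e1
    rw [e1, show a + d + 1 = a + (d + 1) by ring, e2, Nat.add_sub_cancel_left, qfact_succ a,
      qfact_succ d]
    have h1 := qfact_ne_zero a
    have h2 := qfact_ne_zero d
    have h3 := qint_ne_zero (Nat.succ_ne_zero a)
    have h4 := qint_ne_zero (Nat.succ_ne_zero d)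
    field_simp

lemma gaussBinom_succ_succ (m a : ℕ) :
    gaussBinom (m + 1) (a + 1) =
      qq ^ (a + 1) * gaussBinom m (a + 1) + (qq ^ (m - a))⁻¹ * gaussBinom m a := by
  rcases lt_trichotomy m a with h | rfl | h
  · simp [gaussBinom_eq_zero, h, Nat.lt_succ_of_lt h]
  · simp [gaussBinom_self, gaussBinom_eq_zero]
  · obtain ⟨d, rfl⟩ := Nat.exists_eq_add_of_lt h
    have e0 := gaussBinom_add (a + 1) (d + 1)
    have e1 := gaussBinom_add (a + 1) d
    have e2 := gaussBinom_add a (d + 1)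
    have e3 := qint_add (d + 1) (a + 1)
    rw [show a + 1 + (d + 1) = a + d + 1 + 1 by ring, qfact_succ (a + d + 1)] at e0
    rw [show a + 1 + d = a + d + 1 by ring] at e1
    rw [show a + (d + 1) = a + d + 1 by ring] at e2
    rw [show d + 1 + (a + 1) = a + d + 1 + 1 by ring] at e3
    rw [e0, e1, e2, e3, show a + d + 1 - a = d + 1 by omega, qfact_succ a, qfact_succ d]
    have h1 := qfact_ne_zero a
    have h2 := qfact_ne_zero d
    have h3 := qint_ne_zero (Nat.succ_ne_zero a)
    have h4 := qint_ne_zero (Nat.succ_ne_zero d)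
    have h5 := qq_ne_zero
    field_simp

lemma gaussBinom_succ_succ' (m a : ℕ) :
    gaussBinom (m + 1) (a + 1) =
      (qq ^ (a + 1))⁻¹ * gaussBinom m (a + 1) + qq ^ (m - a) * gaussBinom m a := by
  rcases lt_trichotomy m a with h | rfl | h
  · simp [gaussBinom_eq_zero, h, Nat.lt_succ_of_lt h]
  · simp [gaussBinom_self, gaussBinom_eq_zero]
  · obtain ⟨d, rfl⟩ := Nat.exists_eq_add_of_lt h
    have e0 := gaussBinom_add (a + 1) (d + 1)
    have e1 := gaussBinom_add (a + 1) d
    have e2 := gaussBinom_add a (d + 1)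
    have e3 := qint_add' (d + 1) (a + 1)
    rw [show a + 1 + (d + 1) = a + d + 1 + 1 by ring, qfact_succ (a + d + 1)] at e0
    rw [show a + 1 + d = a + d + 1 by ring] at e1
    rw [show a + (d + 1) = a + d + 1 by ring] at e2
    rw [show d + 1 + (a + 1) = a + d + 1 + 1 by ring] at e3
    rw [e0, e1, e2, e3, show a + d + 1 - a = d + 1 by omega, qfact_succ a, qfact_succ d]
    have h1 := qfact_ne_zero a
    have h2 := qfact_ne_zero d
    have h3 := qint_ne_zero (Nat.succ_ne_zero a)
    have h4 := qint_ne_zero (Nat.succ_ne_zero d)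
    have h5 := qq_ne_zero
    field_simp

lemma gaussBinom_mul_gaussBinom (f d c : ℕ) :
    gaussBinom (f + c) (f + d) * gaussBinom (f + d) f =
      gaussBinom (f + c) f * gaussBinom c d := by
  rcases lt_or_ge c d with h | h
  · rw [gaussBinom_eq_zero (by omega), gaussBinom_eq_zero h]
    simp
  · obtain ⟨s, rfl⟩ := Nat.exists_eq_add_of_le h
    rw [← add_assoc, gaussBinom_add (f + d) s, gaussBinom_add f d, gaussBinom_add d s,
      add_assoc, gaussBinom_add f (d + s)]
    have h1 := qfact_ne_zero f
    have h2 := qfact_ne_zero d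
    have h3 := qfact_ne_zero s
    have h4 := qfact_ne_zero (f + d)
    have h5 := qfact_ne_zero (d + s)
    field_simp

/-- The `b`-fold `q`-difference of `a ↦ [a choose r]`. -/
lemma sum_gaussBinom_mul_gaussBinom (b a r : ℕ) :
    ∑ m ∈ Finset.range (b + 1),
      (-1) ^ m * qq ^ ((m : ℤ) * (r - b + 1)) * gaussBinom b m * gaussBinom (a + m) r =
    (-1) ^ b * qq ^ (b * (a + 1)) * (if b ≤ r then gaussBinom a (r - b) else 0) := by
  have hq := qq_ne_zero
  induction b generalizing a with
  | zero => simp [gaussBinom_zero_right]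
  | succ b ih =>
    have step : ∑ m ∈ Finset.range (b + 1 + 1), (-1) ^ m * qq ^ ((m : ℤ) * (r - (b + 1 : ℕ) + 1)) *
          gaussBinom (b + 1) m * gaussBinom (a + m) r =
        (∑ m ∈ Finset.range (b + 1), (-1) ^ m * qq ^ ((m : ℤ) * (r - b + 1)) *
          gaussBinom b m * gaussBinom (a + m) r) -
        qq ^ ((r : ℤ) - 2 * b) * ∑ m ∈ Finset.range (b + 1), (-1) ^ m *
          qq ^ ((m : ℤ) * (r - b + 1)) * gaussBinom b m * gaussBinom (a + 1 + m) r := by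
      have hext : ∑ m ∈ Finset.range (b + 1), (-1) ^ m * qq ^ ((m : ℤ) * (r - b + 1)) *
          gaussBinom b m * gaussBinom (a + m) r =
          ∑ m ∈ Finset.range (b + 1 + 1), (-1) ^ m * qq ^ ((m : ℤ) * (r - b + 1)) *
          gaussBinom b m * gaussBinom (a + m) r := by
        rw [Finset.sum_range_succ _ (b + 1), gaussBinom_eq_zero (Nat.lt_succ_self b)]
        simp
      rw [hext, Finset.sum_range_succ', Finset.sum_range_succ' _ (b + 1), Finset.mul_sum,
        add_sub_right_comm, ← Finset.sum_sub_distrib]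
      congr 1
      · refine Finset.sum_congr rfl fun m hm => ?_
        have hmb : m ≤ b := by simpa [Nat.lt_succ_iff] using hm
        rw [gaussBinom_succ_succ, show a + 1 + m = a + (m + 1) by ring]
        have e1 : qq ^ (((m + 1 : ℕ) : ℤ) * (r - b + 1)) =
            qq ^ (((m + 1 : ℕ) : ℤ) * (r - (b + 1 : ℕ) + 1)) * qq ^ (m + 1) := by
          rw [← zpow_natCast qq (m + 1), ← zpow_add₀ hq]
          congr 1
          push_cast
          ring
        have e2 : qq ^ ((r : ℤ) - 2 * b) * qq ^ ((m : ℤ) * (r - b + 1)) =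
            qq ^ (((m + 1 : ℕ) : ℤ) * (r - (b + 1 : ℕ) + 1)) * (qq ^ (b - m))⁻¹ := by
          rw [← zpow_natCast qq (b - m), ← zpow_neg, ← zpow_add₀ hq, ← zpow_add₀ hq]
          congr 1
          push_cast [Nat.cast_sub hmb]
          ring
        rw [e1]
        linear_combination (-(-1) ^ m * gaussBinom b m * gaussBinom (a + (m + 1)) r) * (-e2)
      · simp [gaussBinom_zero_right]
    rw [step, ih, ih]
    rcases lt_trichotomy r b with h | rfl | h
    · rw [if_neg (by omega), if_neg (by omega), if_neg (by omega)]
      ring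
    · rw [if_pos le_rfl, if_pos le_rfl, if_neg (by omega), Nat.sub_self,
        gaussBinom_zero_right, gaussBinom_zero_right]
      have : qq ^ ((r : ℤ) - 2 * r) * qq ^ (r * (a + 1 + 1)) = qq ^ (r * (a + 1)) := by
        rw [← zpow_natCast, ← zpow_natCast, ← zpow_add₀ hq]
        congr 1
        push_cast
        ring
      linear_combination (-(-1) ^ r) * this
    · obtain ⟨t, rfl⟩ := Nat.exists_eq_add_of_lt h
      rw [if_pos (by omega), if_pos (by omega), if_pos (by omega),
        show b + t + 1 - b = t + 1 by omega, show b + t + 1 - (b + 1) = t by omega,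
        gaussBinom_succ_succ']
      rcases lt_or_ge a t with h' | h'
      · simp [gaussBinom_eq_zero, h', Nat.lt_succ_of_lt h']
      have e1 : qq ^ (((b + t + 1 : ℕ) : ℤ) - 2 * b) * qq ^ (b * (a + 1 + 1)) =
          qq ^ (b * (a + 1)) * qq ^ (t + 1) := by
        rw [← zpow_natCast, ← zpow_natCast, ← zpow_natCast, ← zpow_add₀ hq, ← zpow_add₀ hq]
        congr 1
        push_cast
        ring
      have e2 : qq ^ (t + 1) * qq ^ (a - t) = qq ^ (a + 1) := by
        rw [← pow_add]
        congr 1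
        omega
      have e3 : qq ^ (t + 1) * (qq ^ (t + 1))⁻¹ = 1 := mul_inv_cancel₀ (pow_ne_zero _ hq)
      have e4 : qq ^ ((b + 1) * (a + 1)) = qq ^ (b * (a + 1)) * qq ^ (a + 1) := by
        rw [← pow_add]
        congr 1
        ring
      rw [e4, ← e2]
      linear_combination (-(-1) ^ b * ((qq ^ (t + 1))⁻¹ * gaussBinom a (t + 1) +
        qq ^ (a - t) * gaussBinom a t)) * e1 -
        (-1) ^ b * qq ^ (b * (a + 1)) * gaussBinom a (t + 1) * e3

lemma two_mul_cast_mul_pred_div_two (n : ℕ) :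
    2 * ((n * (n - 1) / 2 : ℕ) : ℤ) = (n : ℤ) * (n - 1) := by
  rcases n with _ | n
  · simp
  · have h : 2 * ((n + 1) * (n + 1 - 1) / 2) = (n + 1) * (n + 1 - 1) :=
      Nat.mul_div_cancel' (even_iff_two_dvd.1 (Nat.even_mul_pred_self (n + 1)))
    have h' := congrArg (Nat.cast : ℕ → ℤ) h
    push_cast at h' ⊢
    simpa using h'

lemma two_mul_sub_mul_div_two (e a b : ℕ) :
    2 * (((e : ℤ) - a) * (2 * b - a - e + 1) / 2) = ((e : ℤ) - a) * (2 * b - a - e + 1) := by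
  refine Int.mul_ediv_cancel' (even_iff_two_dvd.1 ?_)
  rcases Int.even_or_odd ((e : ℤ) - a) with hp | hp
  · exact hp.mul_right _
  · refine Even.mul_left ?_ _
    obtain ⟨t, ht⟩ := hp
    exact ⟨b - t - a, by linear_combination -ht⟩

/-- The truncation of `exp_{q^{-1}}(x)` at order `N`. -/
noncomputable def qexpTrunc {V : Type*} [AddCommGroup V] [Module (RatFunc ℚ) V] (N : ℕ)
    (x : V →ₗ[RatFunc ℚ] V) : V →ₗ[RatFunc ℚ] V :=
  ∑ n ∈ Finset.range (N + 1), (qq ^ (-((n * (n - 1) / 2 : ℕ) : ℤ)) / qfact n) • x ^ n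

section WeightString

variable {V : Type*} [AddCommGroup V] [Module (RatFunc ℚ) V] {u : ℕ → V} {n N : ℕ}

lemma qexpTrunc_apply (x : V →ₗ[RatFunc ℚ] V) (v : V) :
    qexpTrunc N x v = ∑ n ∈ Finset.range (N + 1),
      (qq ^ (-((n * (n - 1) / 2 : ℕ) : ℤ)) / qfact n) • (x ^ n) v := by
  simp [qexpTrunc, LinearMap.sum_apply]

lemma lowering_pow_apply {x : V →ₗ[RatFunc ℚ] V} {ε : ℤ}
    (hx : ∀ b ≤ n, x (u b) = (qq ^ (ε * ((n : ℤ) - 2 * b + 1)) * qint b) • u (b - 1))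
    {b : ℕ} (hb : b ≤ n) (m : ℕ) :
    (x ^ m) (u b) =
      (qfact m * gaussBinom b m * qq ^ (ε * ((m : ℤ) * (n - 2 * b + m)))) • u (b - m) := by
  induction m with
  | zero => simp [gaussBinom_zero_right, qfact]
  | succ m ih =>
    rw [pow_succ', Module.End.mul_apply, ih, map_smul]
    rcases lt_or_ge b m with h | h
    · simp [gaussBinom_eq_zero, h, Nat.lt_succ_of_lt h]
    · rw [hx _ (by omega), smul_smul, Nat.sub_sub]
      congr 1
      have e : qq ^ (ε * (((m + 1 : ℕ) : ℤ) * (n - 2 * b + (m + 1 : ℕ)))) =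
          qq ^ (ε * ((m : ℤ) * (n - 2 * b + m))) *
            qq ^ (ε * ((n : ℤ) - 2 * (b - m : ℕ) + 1)) := by
        rw [← zpow_add₀ qq_ne_zero]
        congr 1
        push_cast [Nat.cast_sub h]
        ring
      rw [qfact_succ, e]
      linear_combination (-qfact m * qq ^ (ε * ((m : ℤ) * (n - 2 * b + m))) *
            qq ^ (ε * ((n : ℤ) - 2 * (b - m : ℕ) + 1))) * qint_mul_gaussBinom_succ b m

lemma raising_pow_apply {x : V →ₗ[RatFunc ℚ] V}
    (hx : ∀ b ≤ n, x (u b) = (-qint (n - b)) • u (b + 1)) {b : ℕ} (hb : b ≤ n) (m : ℕ) :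
    (x ^ m) (u b) = (qfact m * gaussBinom (n - b) m * (-1) ^ m) • u (b + m) := by
  induction m with
  | zero => simp [gaussBinom_zero_right, qfact]
  | succ m ih =>
    rw [pow_succ', Module.End.mul_apply, ih, map_smul]
    rcases lt_or_ge (n - b) m with h | h
    · simp [gaussBinom_eq_zero, h, Nat.lt_succ_of_lt h]
    · rw [hx _ (by omega), smul_smul, add_assoc, ← Nat.sub_sub]
      congr 1
      rw [qfact_succ]
      linear_combination (qfact m * (-1) ^ m) * qint_mul_gaussBinom_succ (n - b) m

lemma sum_range_succ_eq_of_eq_zero {M : Type*} [AddCommMonoid M] {b N : ℕ} (hb : b ≤ N)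
    (f : ℕ → M) (hf : ∀ m, b < m → f m = 0) :
    ∑ m ∈ Finset.range (N + 1), f m = ∑ m ∈ Finset.range (b + 1), f m := by
  refine (Finset.sum_subset (Finset.range_subset_range.2 (by omega)) fun m _ hm => hf m ?_).symm
  simpa [Nat.lt_succ_iff] using hm

lemma qexpTrunc_lowering {x : V →ₗ[RatFunc ℚ] V} {ε : ℤ}
    (hx : ∀ b ≤ n, x (u b) = (qq ^ (ε * ((n : ℤ) - 2 * b + 1)) * qint b) • u (b - 1))
    (hN : n ≤ N) {b : ℕ} (hb : b ≤ n) :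
    qexpTrunc N x (u b) = ∑ c ∈ Finset.range (b + 1),
      (qq ^ (ε * (((b : ℤ) - c) * (n - b - c)) - (((b - c) * (b - c - 1) / 2 : ℕ) : ℤ)) *
        gaussBinom b c) • u c := by
  rw [qexpTrunc_apply, sum_range_succ_eq_of_eq_zero (hb.trans hN), ← Finset.sum_range_reflect]
  · refine Finset.sum_congr rfl fun c hc => ?_
    have hcb : c ≤ b := by simpa [Nat.lt_succ_iff] using hc
    rw [show b + 1 - 1 - c = b - c by omega, lowering_pow_apply hx hb, smul_smul,
      gaussBinom_symm hcb, Nat.sub_sub_self hcb]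
    congr 1
    rw [zpow_sub₀ qq_ne_zero, zpow_neg,
      show ε * (((b : ℤ) - c) * (n - b - c)) =
        ε * (((b - c : ℕ) : ℤ) * (n - 2 * b + (b - c : ℕ))) by
          push_cast [Nat.cast_sub hcb]; ring]
    have := qfact_ne_zero (b - c)
    field_simp
  · intro m hm
    rw [lowering_pow_apply hx hb, gaussBinom_eq_zero hm]
    simp

lemma qexpTrunc_raising {x : V →ₗ[RatFunc ℚ] V}
    (hx : ∀ b ≤ n, x (u b) = (-qint (n - b)) • u (b + 1))
    (hN : n ≤ N) {b : ℕ} (hb : b ≤ n) :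
    qexpTrunc N x (u b) = ∑ r ∈ Finset.range (n + 1),
      ((-1) ^ (n - b + r) *
        qq ^ (-(((n - b - r) * (n - b - r - 1) / 2 : ℕ) : ℤ)) *
        gaussBinom (n - b) r) • u (n - r) := by
  have hbN : n - b ≤ N := by omega
  rw [qexpTrunc_apply, sum_range_succ_eq_of_eq_zero hbN,
    sum_range_succ_eq_of_eq_zero (Nat.sub_le n b) _, ← Finset.sum_range_reflect]
  · refine Finset.sum_congr rfl fun r hr => ?_
    have hrb : r ≤ n - b := by simpa [Nat.lt_succ_iff] using hr
    rw [show n - b + 1 - 1 - r = n - b - r by omega, raising_pow_apply hx hb, smul_smul,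
      gaussBinom_symm hrb, show b + (n - b - r) = n - r by omega]
    congr 1
    have e : (-1 : RatFunc ℚ) ^ (n - b + r) = (-1) ^ (n - b - r) := by
      rw [show n - b + r = n - b - r + 2 * r by omega, pow_add, pow_mul]
      simp
    rw [e]
    have := qfact_ne_zero (n - b - r)
    field_simp
  · intro m hm
    rw [gaussBinom_eq_zero hm]
    simp
  · intro m hm
    rw [raising_pow_apply hx hb, gaussBinom_eq_zero hm]
    simp

lemma qexpTrunc_raising_lowering {E F : V →ₗ[RatFunc ℚ] V}
    (hE : ∀ b ≤ n, E (u b) = (qq ^ (1 * ((n : ℤ) - 2 * b + 1)) * qint b) • u (b - 1))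
    (hF : ∀ b ≤ n, F (u b) = (-qint (n - b)) • u (b + 1))
    (hN : n ≤ N) {a b : ℕ} (hab : a + b = n) :
    qexpTrunc N F (qexpTrunc N E
        (qq ^ (((a : ℤ) - b) * ((a : ℤ) - b + 1) / 2) • u b)) =
      ∑ e ∈ Finset.range (n + 1), ((-1) ^ e *
        qq ^ ((a : ℤ) * (b + 1) + ((e : ℤ) - a) * (2 * b - a - e + 1) / 2) *
          gaussBinom a e) • u e := by
  have hq := qq_ne_zero
  rw [map_smul, qexpTrunc_lowering hE hN (by omega), map_smul, map_sum, Finset.smul_sum]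
  have h1 : ∀ c ∈ Finset.range (b + 1),
      qq ^ (((a : ℤ) - b) * ((a : ℤ) - b + 1) / 2) • qexpTrunc N F
        ((qq ^ (1 * (((b : ℤ) - c) * (n - b - c)) - (((b - c) * (b - c - 1) / 2 : ℕ) : ℤ)) *
        gaussBinom b c) • u c) =
      ∑ r ∈ Finset.range (n + 1), (qq ^ (((a : ℤ) - b) * ((a : ℤ) - b + 1) / 2) *
        (qq ^ (1 * (((b : ℤ) - c) * (n - b - c)) - (((b - c) * (b - c - 1) / 2 : ℕ) : ℤ)) *
        gaussBinom b c) * ((-1) ^ (n - c + r) *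
        qq ^ (-(((n - c - r) * (n - c - r - 1) / 2 : ℕ) : ℤ)) *
        gaussBinom (n - c) r)) • u (n - r) := by
    intro c hc
    have hcb : c ≤ b := by simpa [Nat.lt_succ_iff] using hc
    rw [map_smul, qexpTrunc_raising hF hN (by omega), Finset.smul_sum, Finset.smul_sum]
    simp only [smul_smul, mul_assoc]
  rw [Finset.sum_congr rfl h1, Finset.sum_comm, ← Finset.sum_range_reflect _ (n + 1)]
  refine Finset.sum_congr rfl fun e he => ?_
  have hen : e ≤ n := by simpa [Nat.lt_succ_iff] using he
  rw [← Finset.sum_smul, show n + 1 - 1 - e = n - e by omega, Nat.sub_sub_self hen]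
  congr 1
  have key := sum_gaussBinom_mul_gaussBinom b a (n - e)
  have hR : (if b ≤ n - e then gaussBinom a (n - e - b) else 0) = gaussBinom a e := by
    split_ifs with h
    · rw [show n - e - b = a - e by omega, gaussBinom_symm (by omega)]
    · rw [gaussBinom_eq_zero (by omega)]
  rw [hR] at key
  rw [← Finset.sum_range_reflect]
  have h2 : ∀ m ∈ Finset.range (b + 1),
      qq ^ (((a : ℤ) - b) * ((a : ℤ) - b + 1) / 2) *
        (qq ^ (1 * (((b : ℤ) - (b + 1 - 1 - m : ℕ)) * (n - b - (b + 1 - 1 - m : ℕ))) -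
          (((b - (b + 1 - 1 - m)) * (b - (b + 1 - 1 - m) - 1) / 2 : ℕ) : ℤ)) *
        gaussBinom b (b + 1 - 1 - m)) * ((-1) ^ (n - (b + 1 - 1 - m) + (n - e)) *
        qq ^ (-(((n - (b + 1 - 1 - m) - (n - e)) *
          (n - (b + 1 - 1 - m) - (n - e) - 1) / 2 : ℕ) : ℤ)) *
        gaussBinom (n - (b + 1 - 1 - m)) (n - e)) =
      ((-1) ^ (b + e) * qq ^ ((a : ℤ) - b + ((e : ℤ) - a) * (2 * b - a - e + 1) / 2)) *
      ((-1) ^ m * qq ^ ((m : ℤ) * ((n - e : ℕ) - b + 1)) * gaussBinom b m *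
        gaussBinom (a + m) (n - e)) := by
    intro m hm
    have hmb : m ≤ b := by simpa [Nat.lt_succ_iff] using hm
    rw [show b + 1 - 1 - m = b - m by omega, Nat.sub_sub_self hmb, gaussBinom_symm hmb,
      show n - (b - m) = a + m by omega]
    rcases lt_or_ge (a + m) (n - e) with h | h
    · simp [gaussBinom_eq_zero h]
    have hs : (-1 : RatFunc ℚ) ^ (a + m + (n - e)) = (-1) ^ (b + e) * (-1) ^ m := by
      rw [← pow_add, show a + m + (n - e) = 2 * a + b - e + m by omega]
      have : 2 * a + b - e + m + 2 * e = b + e + m + 2 * a := by omega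
      have h' := congrArg (fun t : ℕ => (-1 : RatFunc ℚ) ^ t) this
      simpa [pow_add, pow_mul] using h'
    have hexp : qq ^ (((a : ℤ) - b) * ((a : ℤ) - b + 1) / 2) *
        qq ^ (1 * (((b : ℤ) - (b - m : ℕ)) * (n - b - (b - m : ℕ))) -
          ((m * (m - 1) / 2 : ℕ) : ℤ)) *
        qq ^ (-(((a + m - (n - e)) * (a + m - (n - e) - 1) / 2 : ℕ) : ℤ)) =
        qq ^ ((a : ℤ) - b + ((e : ℤ) - a) * (2 * b - a - e + 1) / 2) *
          qq ^ ((m : ℤ) * ((n - e : ℕ) - b + 1)) := by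
      rw [← zpow_add₀ hq, ← zpow_add₀ hq, ← zpow_add₀ hq]
      congr 1
      have t1 := two_mul_cast_mul_pred_div_two m
      have t2 := two_mul_cast_mul_pred_div_two (a + m - (n - e))
      have t3 : 2 * (((a : ℤ) - b) * ((a : ℤ) - b + 1) / 2) = ((a : ℤ) - b) * ((a : ℤ) - b + 1) :=
        Int.mul_ediv_cancel' (even_iff_two_dvd.1 (Int.even_mul_succ_self _))
      have t4 := two_mul_sub_mul_div_two e a b
      apply mul_left_cancel₀ (two_ne_zero' ℤ)
      rw [Nat.cast_sub h] at t2
      push_cast [Nat.cast_sub hmb, Nat.cast_sub hen] at t1 t2 ⊢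
      have hn : (n : ℤ) = a + b := by exact_mod_cast hab.symm
      rw [hn] at t2 ⊢
      linear_combination t3 - t4 - t1 - t2
    rw [hs]
    linear_combination ((-1) ^ (b + e) * (-1) ^ m * gaussBinom b m *
      gaussBinom (a + m) (n - e)) * hexp
  rw [Finset.sum_congr rfl h2, ← Finset.mul_sum, key]
  have e1 : qq ^ ((a : ℤ) * (b + 1) + ((e : ℤ) - a) * (2 * b - a - e + 1) / 2) =
      qq ^ ((a : ℤ) - b + ((e : ℤ) - a) * (2 * b - a - e + 1) / 2) * qq ^ (b * (a + 1)) := by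
    rw [← zpow_natCast qq (b * (a + 1)), ← zpow_add₀ hq]
    congr 1
    push_cast
    ring
  have e2 : (-1 : RatFunc ℚ) ^ (b + e) * (-1) ^ b = (-1) ^ e := by
    rw [pow_add, mul_right_comm, ← pow_add, ← two_mul, pow_mul]
    simp
  rw [e1, ← e2]
  ring

lemma weyl_on_weightString {E F E' : V →ₗ[RatFunc ℚ] V}
    (hE : ∀ b ≤ n, E (u b) = (qq ^ (1 * ((n : ℤ) - 2 * b + 1)) * qint b) • u (b - 1))
    (hF : ∀ b ≤ n, F (u b) = (-qint (n - b)) • u (b + 1))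
    (hE' : ∀ b ≤ n, E' (u b) = (qq ^ ((-1) * ((n : ℤ) - 2 * b + 1)) * qint b) • u (b - 1))
    (hN : n ≤ N) {a b : ℕ} (hab : a + b = n) :
    qexpTrunc N E' (qexpTrunc N F (qexpTrunc N E
        (qq ^ (((a : ℤ) - b) * ((a : ℤ) - b + 1) / 2) • u b))) =
      ((-1) ^ a * qq ^ (a * (b + 1))) • u a := by
  have hq := qq_ne_zero
  rw [qexpTrunc_raising_lowering hE hF hN hab, map_sum]
  have h1 : ∀ e ∈ Finset.range (n + 1), qexpTrunc N E' (((-1) ^ e *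
        qq ^ ((a : ℤ) * (b + 1) + ((e : ℤ) - a) * (2 * b - a - e + 1) / 2) *
          gaussBinom a e) • u e) =
      ∑ f ∈ Finset.range (n + 1), (((-1) ^ e *
        qq ^ ((a : ℤ) * (b + 1) + ((e : ℤ) - a) * (2 * b - a - e + 1) / 2) *
          gaussBinom a e) * (qq ^ ((-1) * (((e : ℤ) - f) * (n - e - f)) -
            (((e - f) * (e - f - 1) / 2 : ℕ) : ℤ)) * gaussBinom e f)) • u f := by
    intro e he
    have hen : e ≤ n := by simpa [Nat.lt_succ_iff] using he
    rw [map_smul, qexpTrunc_lowering hE' hN hen,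
      ← sum_range_succ_eq_of_eq_zero hen _ fun m hm => ?_, Finset.smul_sum]
    · simp only [smul_smul]
    · rw [gaussBinom_eq_zero hm]
      simp
  rw [Finset.sum_congr rfl h1, Finset.sum_comm]
  simp only [← Finset.sum_smul]
  rw [Finset.sum_eq_single a]
  · congr 1
    rw [Finset.sum_eq_single a]
    · simp [gaussBinom_self, ← zpow_natCast]
    · intro e _ hea
      rcases lt_or_gt_of_ne hea with h | h <;> simp [gaussBinom_eq_zero h]
    · simp
      omega
  · intro f hf hfa
    have hfn : f ≤ n := by simpa [Nat.lt_succ_iff] using hf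
    convert zero_smul (RatFunc ℚ) (u f)
    rcases lt_or_gt_of_ne hfa with h | h
    swap
    · refine Finset.sum_eq_zero fun e _ => ?_
      rcases lt_or_ge a e with h' | h'
      · simp [gaussBinom_eq_zero h']
      · simp [gaussBinom_eq_zero (show e < f by omega)]
    obtain ⟨c, rfl⟩ := Nat.exists_eq_add_of_lt h
    rw [← Finset.sum_subset (s₁ := Finset.Ico f (f + c + 1 + 1))]
    · rw [Finset.sum_Ico_eq_sum_range, show f + c + 1 + 1 - f = c + 1 + 1 by omega]
      have key := sum_gaussBinom_mul_gaussBinom (c + 1) 0 0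
      simp only [gaussBinom_zero_right, mul_one] at key
      rw [if_neg (by omega), mul_zero] at key
      have h2 : ∀ d ∈ Finset.range (c + 1 + 1),
          ((-1) ^ (f + d) * qq ^ (((f + c + 1 : ℕ) : ℤ) * (b + 1) +
              (((f + d : ℕ) : ℤ) - (f + c + 1 : ℕ)) *
                (2 * b - (f + c + 1 : ℕ) - (f + d : ℕ) + 1) / 2) *
            gaussBinom (f + c + 1) (f + d)) *
          (qq ^ ((-1) * ((((f + d : ℕ) : ℤ) - f) * (n - (f + d : ℕ) - f)) -
            (((f + d - f) * (f + d - f - 1) / 2 : ℕ) : ℤ)) * gaussBinom (f + d) f) =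
          ((-1) ^ f * gaussBinom (f + c + 1) f * qq ^ (((f + c + 1 : ℕ) : ℤ) * (b + 1) +
              (-((c : ℤ) + 1)) * (2 * b - (f + c + 1 : ℕ) - f + 1) / 2)) *
          ((-1) ^ d * qq ^ ((d : ℤ) * (((0 : ℕ) : ℤ) - (c + 1 : ℕ) + 1)) *
            gaussBinom (c + 1) d) := by
        intro d _
        have hexp : qq ^ (((f + c + 1 : ℕ) : ℤ) * (b + 1) +
              (((f + d : ℕ) : ℤ) - (f + c + 1 : ℕ)) *
                (2 * b - (f + c + 1 : ℕ) - (f + d : ℕ) + 1) / 2) *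
            qq ^ ((-1) * ((((f + d : ℕ) : ℤ) - f) * (n - (f + d : ℕ) - f)) -
            ((d * (d - 1) / 2 : ℕ) : ℤ)) =
            qq ^ (((f + c + 1 : ℕ) : ℤ) * (b + 1) +
              (-((c : ℤ) + 1)) * (2 * b - (f + c + 1 : ℕ) - f + 1) / 2) *
              qq ^ ((d : ℤ) * (((0 : ℕ) : ℤ) - (c + 1 : ℕ) + 1)) := by
          rw [← zpow_add₀ hq, ← zpow_add₀ hq]
          congr 1
          have t1 := two_mul_cast_mul_pred_div_two d
          have t2 := two_mul_sub_mul_div_two (f + d) (f + c + 1) b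
          have t3 := two_mul_sub_mul_div_two f (f + c + 1) b
          have hn : (n : ℤ) = ((f + c + 1 : ℕ) : ℤ) + b := by exact_mod_cast hab.symm
          rw [show -((c : ℤ) + 1) = (f : ℤ) - (f + c + 1 : ℕ) by push_cast; ring, hn]
          apply mul_left_cancel₀ (two_ne_zero' ℤ)
          linear_combination (norm := skip) t2 - t3 - t1
          push_cast
          ring
        have htri := gaussBinom_mul_gaussBinom f d (c + 1)
        rw [← add_assoc] at htri
        rw [Nat.add_sub_cancel_left, pow_add]
        rw [show ∀ A B C D E G : RatFunc ℚ, A * B * C * D * (E * G) = A * B * (C * E) * (D * G)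
          by intros; ring, htri, hexp]
        ring
      rw [Finset.sum_congr rfl h2, ← Finset.mul_sum, key, mul_zero]
    · intro e he
      simp only [Finset.mem_Ico, Finset.mem_range] at he ⊢
      omega
    · intro e _ he
      simp only [Finset.mem_Ico, not_and_or, not_le, not_lt] at he
      rcases he with he | he
      · simp [gaussBinom_eq_zero he]
      · simp [gaussBinom_eq_zero (show f + c + 1 < e by omega)]
  · simp
    omega

end WeightString

/-- The exponent function supported on the first two rows, with values `x, y` in the first row
and `z, t` in the second row. -/
def twoRow (k x y z t : ℕ) : Fin (k + 2) × Fin 2 → ℕ := fun p =>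
  if p = (0, 0) then x else if p = (1, 0) then z else if p = (0, 1) then y
  else if p = (1, 1) then t else 0

section TwoRow

variable {k : ℕ}

lemma mkOp_Xb {f : (Fin k × Fin 2 → ℕ) → Mmod k} (m : Fin k × Fin 2 → ℕ) :
    mkOp f (Xb m) = f m := by
  simp [mkOp, Xb]

@[simp] lemma twoRow_zero_zero (x y z t : ℕ) : twoRow k x y z t (0, 0) = x := by simp [twoRow]
@[simp] lemma twoRow_zero_one (x y z t : ℕ) : twoRow k x y z t (0, 1) = y := by simp [twoRow]
@[simp] lemma twoRow_one_zero (x y z t : ℕ) : twoRow k x y z t (1, 0) = z := by simp [twoRow]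
@[simp] lemma twoRow_one_one (x y z t : ℕ) : twoRow k x y z t (1, 1) = t := by simp [twoRow]
@[simp] lemma twoRow_succ_succ (x y z t : ℕ) (j : Fin k) (c : Fin 2) :
    twoRow k x y z t (j.succ.succ, c) = 0 := by
  simp [twoRow, Fin.succ_ne_zero, ← Fin.succ_zero_eq_one, - Fin.succ_zero_eq_one']

lemma shiftExp_twoRow_raise_zero (x y z t : ℕ) :
    shiftExp (twoRow k x y z t) (0, 0) (0, 1) = twoRow k (x + 1) (y - 1) z t := by
  funext p
  simp only [shiftExp, twoRow]
  split_ifs <;> simp_all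

lemma shiftExp_twoRow_raise_one (x y z t : ℕ) :
    shiftExp (twoRow k x y z t) (1, 0) (1, 1) = twoRow k x y (z + 1) (t - 1) := by
  funext p
  simp only [shiftExp, twoRow]
  split_ifs <;> simp_all

lemma shiftExp_twoRow_lower_zero (x y z t : ℕ) :
    shiftExp (twoRow k x y z t) (0, 1) (0, 0) = twoRow k (x - 1) (y + 1) z t := by
  funext p
  simp only [shiftExp, twoRow]
  split_ifs <;> simp_all

lemma shiftExp_twoRow_lower_one (x y z t : ℕ) :
    shiftExp (twoRow k x y z t) (1, 1) (1, 0) = twoRow k x y (z - 1) (t + 1) := by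
  funext p
  simp only [shiftExp, twoRow]
  split_ifs <;> simp_all

lemma Fop_Xb_twoRow (x y z t : ℕ) :
    Fop (k + 2) (Xb (twoRow k x y z t)) =
      qint x • Xb (twoRow k (x - 1) (y + 1) z t) +
      (qint z * qq ^ (-((x : ℤ) - y))) • Xb (twoRow k x y (z - 1) (t + 1)) := by
  rw [Fop, mkOp_Xb]
  simp [Fin.sum_univ_succ, Fin.prod_univ_succ, qint_zero, shiftExp_twoRow_lower_zero,
    shiftExp_twoRow_lower_one]

lemma Eop_Xb_twoRow (x y z t : ℕ) :
    Eop (k + 2) (Xb (twoRow k x y z t)) =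
      (qint y * qq ^ ((z : ℤ) - t)) • Xb (twoRow k (x + 1) (y - 1) z t) +
      qint t • Xb (twoRow k x y (z + 1) (t - 1)) := by
  rw [Eop, mkOp_Xb]
  simp [Fin.sum_univ_succ, Fin.prod_univ_succ, qint_zero, shiftExp_twoRow_raise_zero,
    shiftExp_twoRow_raise_one]

lemma qHop_Xb_twoRow (f : ℤ → ℤ) (x y z t : ℕ) :
    qHop (k + 2) f (Xb (twoRow k x y z t)) =
      qq ^ f ((x : ℤ) - y + (z - t)) • Xb (twoRow k x y z t) := by
  rw [qHop, mkOp_Xb]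
  congr 3
  simp only [Fin.sum_univ_succ, Fin.succ_zero_eq_one, twoRow_zero_zero, twoRow_zero_one,
    twoRow_one_zero, twoRow_one_one, twoRow_succ_succ]
  simp

lemma sum_twoRow (x y z t : ℕ) : ∑ p, twoRow k x y z t p = x + y + (z + t) := by
  simp [Fintype.sum_prod_type, Fin.sum_univ_succ]

lemma vvec_eq_sum_twoRow (hk : 2 ≤ k + 2) (μ₁ μ₂ i : ℕ) :
    vvec hk μ₁ μ₂ i = ∑ a ∈ Finset.range (i + 1),
      ((-1) ^ a * gaussBinom i a * qq ^ (a * (μ₂ - a + 1))) •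
        Xb (twoRow k (μ₁ - i + a) (μ₂ - a) (i - a) a) := by
  refine Finset.sum_congr rfl fun a ha => ?_
  rw [gaussBinom_of_le (by simpa [Nat.lt_succ_iff] using ha)]
  rfl

lemma qHop_vvec (hk : 2 ≤ k + 2) (f : ℤ → ℤ) {μ₁ μ₂ i : ℕ} (h₁ : i ≤ μ₁) (h₂ : i ≤ μ₂) :
    qHop (k + 2) f (vvec hk μ₁ μ₂ i) = qq ^ f ((μ₁ : ℤ) - μ₂) • vvec hk μ₁ μ₂ i := by
  rw [vvec_eq_sum_twoRow, map_sum, Finset.smul_sum]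
  refine Finset.sum_congr rfl fun a ha => ?_
  have hai : a ≤ i := by simpa [Nat.lt_succ_iff] using ha
  rw [map_smul, qHop_Xb_twoRow, smul_comm]
  congr 3
  push_cast [Nat.cast_sub h₁, Nat.cast_sub hai, Nat.cast_sub (hai.trans h₂)]
  ring

lemma Eop_vvec (hk : 2 ≤ k + 2) {μ₁ μ₂ i : ℕ} (h₁ : i ≤ μ₁) (h₂ : i ≤ μ₂) :
    Eop (k + 2) (vvec hk μ₁ μ₂ i) = qint (μ₂ - i) • vvec hk (μ₁ + 1) (μ₂ - 1) i := by
  have hq := qq_ne_zero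
  have h : ∀ a ∈ Finset.range (i + 1), Eop (k + 2) (((-1) ^ a * gaussBinom i a *
        qq ^ (a * (μ₂ - a + 1))) • Xb (twoRow k (μ₁ - i + a) (μ₂ - a) (i - a) a)) =
      ((-1) ^ a * gaussBinom i a * qq ^ (a * (μ₂ - a + 1)) *
        (qint (μ₂ - a) * qq ^ (((i - a : ℕ) : ℤ) - a))) •
          Xb (twoRow k (μ₁ + 1 - i + a) (μ₂ - 1 - a) (i - a) a) +
      ((-1) ^ a * gaussBinom i a * qq ^ (a * (μ₂ - a + 1)) * qint a) •
          Xb (twoRow k (μ₁ - i + a) (μ₂ - a) (i - a + 1) (a - 1)) := by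
    intro a _
    rw [map_smul, Eop_Xb_twoRow, smul_add, smul_smul, smul_smul,
      show μ₁ - i + a + 1 = μ₁ + 1 - i + a by omega, Nat.sub_right_comm]
  have h' : ∑ a ∈ Finset.range (i + 1), ((-1) ^ a * gaussBinom i a *
        qq ^ (a * (μ₂ - a + 1)) * qint a) •
          Xb (twoRow k (μ₁ - i + a) (μ₂ - a) (i - a + 1) (a - 1)) =
      ∑ a ∈ Finset.range (i + 1), ((-1) ^ (a + 1) * gaussBinom i (a + 1) *
        qq ^ ((a + 1) * (μ₂ - a)) * qint (a + 1)) •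
          Xb (twoRow k (μ₁ + 1 - i + a) (μ₂ - 1 - a) (i - a) a) := by
    rw [Finset.sum_range_succ' _ i, Finset.sum_range_succ _ i,
      gaussBinom_eq_zero (Nat.lt_succ_self i), qint_zero, mul_zero, mul_zero, zero_mul,
      zero_mul, zero_smul, zero_smul, add_zero, add_zero]
    refine Finset.sum_congr rfl fun a ha => ?_
    have hai : a < i := by simpa using ha
    rw [show μ₂ - (a + 1) + 1 = μ₂ - a by omega, show μ₁ - i + (a + 1) = μ₁ + 1 - i + a by omega,
      show μ₂ - (a + 1) = μ₂ - 1 - a by omega, show i - (a + 1) + 1 = i - a by omega,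
      Nat.add_sub_cancel]
  rw [vvec_eq_sum_twoRow, vvec_eq_sum_twoRow, map_sum, Finset.sum_congr rfl h,
    Finset.sum_add_distrib, h', ← Finset.sum_add_distrib, Finset.smul_sum]
  refine Finset.sum_congr rfl fun a ha => ?_
  have hai : a ≤ i := by simpa [Nat.lt_succ_iff] using ha
  rw [← add_smul, smul_smul]
  congr 1
  obtain ⟨d, rfl⟩ := Nat.exists_eq_add_of_le hai
  obtain ⟨c, rfl⟩ := Nat.exists_eq_add_of_le h₂
  have hg := qint_mul_gaussBinom_succ (a + d) a
  rw [Nat.add_sub_cancel_left] at hg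
  have hc : qq ^ d * qint (c + d) = qint c + qq ^ (c + d) * qint d := by
    rw [qint_add', pow_add]
    field_simp
  have hlast : qint c * qq ^ (a * (a + d + c - 1 - a + 1)) = qint c * qq ^ (a * (c + d)) := by
    rcases Nat.eq_zero_or_pos c with rfl | h0
    · simp [qint_zero]
    · rw [show a + d + c - 1 - a + 1 = c + d by omega]
  have e1 : qq ^ (a * (c + d + 1)) * qq ^ ((d : ℤ) - a) = qq ^ (a * (c + d)) * qq ^ d := by
    rw [← zpow_natCast, ← zpow_natCast, ← zpow_natCast, ← zpow_add₀ hq, ← zpow_add₀ hq]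
    congr 1
    push_cast
    ring
  have e2 : qq ^ ((a + 1) * (c + d)) = qq ^ (a * (c + d)) * qq ^ (c + d) := by
    rw [← pow_add]
    congr 1
    ring
  rw [Nat.add_sub_cancel_left, Nat.add_sub_cancel_left, show a + d + c - a = c + d by omega, e2]
  linear_combination ((-1) ^ a * gaussBinom (a + d) a) * (qint (c + d) * e1 +
    qq ^ (a * (c + d)) * hc - hlast) - (-1) ^ a * qq ^ (a * (c + d)) * qq ^ (c + d) * hg

lemma Fop_vvec (hk : 2 ≤ k + 2) {μ₁ μ₂ i : ℕ} (h₁ : i ≤ μ₁) (h₂ : i ≤ μ₂) :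
    Fop (k + 2) (vvec hk μ₁ μ₂ i) = qint (μ₁ - i) • vvec hk (μ₁ - 1) (μ₂ + 1) i := by
  have hq := qq_ne_zero
  have h : ∀ a ∈ Finset.range (i + 1), Fop (k + 2) (((-1) ^ a * gaussBinom i a *
        qq ^ (a * (μ₂ - a + 1))) • Xb (twoRow k (μ₁ - i + a) (μ₂ - a) (i - a) a)) =
      ((-1) ^ a * gaussBinom i a * qq ^ (a * (μ₂ - a + 1)) * qint (μ₁ - i + a)) •
          Xb (twoRow k (μ₁ - i + a - 1) (μ₂ + 1 - a) (i - a) a) +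
      ((-1) ^ a * gaussBinom i a * qq ^ (a * (μ₂ - a + 1)) *
        (qint (i - a) * qq ^ (-(((μ₁ - i + a : ℕ) : ℤ) - (μ₂ - a : ℕ))))) •
          Xb (twoRow k (μ₁ - i + a) (μ₂ - a) (i - a - 1) (a + 1)) := by
    intro a ha
    have hai : a ≤ i := by simpa [Nat.lt_succ_iff] using ha
    rw [map_smul, Fop_Xb_twoRow, smul_add, smul_smul, smul_smul,
      show μ₂ - a + 1 = μ₂ + 1 - a by omega]
  have h' : ∑ a ∈ Finset.range (i + 1), ((-1) ^ a * gaussBinom i a *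
        qq ^ (a * (μ₂ - a + 1)) *
        (qint (i - a) * qq ^ (-(((μ₁ - i + a : ℕ) : ℤ) - (μ₂ - a : ℕ))))) •
          Xb (twoRow k (μ₁ - i + a) (μ₂ - a) (i - a - 1) (a + 1)) =
      ∑ a ∈ Finset.range (i + 1), (-((-1) ^ a * (qint a * gaussBinom i a) *
        qq ^ (((a : ℤ) - 1) * (μ₂ - a + 2) - (μ₁ - i + 2 * a - 2 - μ₂)))) •
          Xb (twoRow k (μ₁ - i + a - 1) (μ₂ + 1 - a) (i - a) a) := by
    rw [Finset.sum_range_succ _ i, Finset.sum_range_succ' _ i, Nat.sub_self,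
      qint_zero, zero_mul, zero_mul, mul_zero, mul_zero, zero_mul, neg_zero, zero_smul,
      zero_smul, add_zero, add_zero]
    refine Finset.sum_congr rfl fun a ha => ?_
    have hai : a < i := by simpa using ha
    rw [show μ₂ + 1 - (a + 1) = μ₂ - a by omega, show μ₁ - i + (a + 1) - 1 = μ₁ - i + a by omega,
      qint_mul_gaussBinom_succ, Nat.sub_sub]
    congr 1
    have e : qq ^ ((((a + 1 : ℕ) : ℤ) - 1) * (μ₂ - (a + 1 : ℕ) + 2) -
          (μ₁ - i + 2 * (a + 1 : ℕ) - 2 - μ₂)) =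
        qq ^ (a * (μ₂ - a + 1)) * qq ^ (-(((μ₁ - i + a : ℕ) : ℤ) - (μ₂ - a : ℕ))) := by
      rw [← zpow_natCast, ← zpow_add₀ hq]
      congr 1
      push_cast [Nat.cast_sub h₁, Nat.cast_sub (hai.le.trans h₂)]
      ring
    rw [e]
    ring
  rw [vvec_eq_sum_twoRow, vvec_eq_sum_twoRow, map_sum, Finset.sum_congr rfl h,
    Finset.sum_add_distrib, h', ← Finset.sum_add_distrib, Finset.smul_sum]
  refine Finset.sum_congr rfl fun a ha => ?_
  have hai : a ≤ i := by simpa [Nat.lt_succ_iff] using ha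
  have hμ : a ≤ μ₂ := hai.trans h₂
  obtain ⟨c, rfl⟩ := Nat.exists_eq_add_of_le h₁
  rw [← add_smul, smul_smul, Nat.add_sub_cancel_left]
  have hscal : (-1) ^ a * gaussBinom i a * qq ^ (a * (μ₂ - a + 1)) * qint (c + a) +
      -((-1) ^ a * (qint a * gaussBinom i a) *
        qq ^ (((a : ℤ) - 1) * (μ₂ - a + 2) - ((i + c : ℕ) - i + 2 * a - 2 - μ₂))) =
      qint c * ((-1) ^ a * gaussBinom i a * qq ^ (a * (μ₂ + 1 - a + 1))) := by
    have e1 : qq ^ (a * (μ₂ + 1 - a + 1)) = qq ^ (a * (μ₂ - a + 1)) * qq ^ a := by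
      rw [← pow_add]
      congr 1
      rw [show μ₂ + 1 - a + 1 = μ₂ - a + 1 + 1 by omega]
      ring
    have e2 : qq ^ (((a : ℤ) - 1) * (μ₂ - a + 2) - ((i + c : ℕ) - i + 2 * a - 2 - μ₂)) =
        qq ^ (a * (μ₂ - a + 1)) * (qq ^ c)⁻¹ := by
      rw [← zpow_natCast, ← zpow_natCast, ← zpow_neg, ← zpow_add₀ hq]
      congr 1
      push_cast [Nat.cast_sub hμ]
      ring
    rw [e1, e2, qint_add]
    ring
  rw [hscal]
  rcases Nat.eq_zero_or_pos c with rfl | h0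
  · simp [qint_zero]
  · rw [show c + a - 1 = i + c - 1 - i + a by omega]

end TwoRow

lemma tdeg_eq_of_mem_supported {k N : ℕ} {v : Mmod k}
    (hv : v ∈ Finsupp.supported (RatFunc ℚ) (RatFunc ℚ) {m | ∑ p, m p = N}) (h0 : v ≠ 0) :
    tdeg v = N := by
  rw [Finsupp.mem_supported] at hv
  have h : tdeg v = v.support.sup fun _ => N := Finset.sup_congr rfl fun m hm => hv hm
  rw [h, Finset.sup_const (Finsupp.support_nonempty_iff.2 h0)]

lemma qexpApp_eq_qexpTrunc {k N : ℕ} {v : Mmod k}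
    (hv : v ∈ Finsupp.supported (RatFunc ℚ) (RatFunc ℚ) {m | ∑ p, m p = N})
    (x : Mmod k →ₗ[RatFunc ℚ] Mmod k) : qexpApp x v = qexpTrunc N x v := by
  by_cases h0 : v = 0
  · simp [qexpApp, h0]
  · rw [qexpApp, tdeg_eq_of_mem_supported hv h0, qexpTrunc_apply]

lemma vvec_mem_supported {k : ℕ} (hk : 2 ≤ k + 2) {μ₁ μ₂ i : ℕ} (h₁ : i ≤ μ₁) (h₂ : i ≤ μ₂) :
    vvec hk μ₁ μ₂ i ∈
      Finsupp.supported (RatFunc ℚ) (RatFunc ℚ) {m | ∑ p, m p = μ₁ + μ₂} := by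
  rw [vvec_eq_sum_twoRow]
  refine Submodule.sum_mem _ fun a ha => Submodule.smul_mem _ _ ?_
  have hai : a ≤ i := by simpa [Nat.lt_succ_iff] using ha
  refine Finsupp.single_mem_supported _ _ ?_
  rw [Set.mem_ofPred_eq, sum_twoRow]
  omega

/-- Action of the quantum Weyl group operator on the highest weight vectors:
`S v_i^{μ₁,μ₂} = (−1)^{μ₁−i} q^{(μ₁−i)(μ₂−i+1)} v_i^{μ₂,μ₁}`. -/
theorem S_on_vvec {k : ℕ} (hk : 2 ≤ k) (μ₁ μ₂ i : ℕ)
    (hi₁ : i ≤ μ₁) (hi₂ : i ≤ μ₂) :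
    Sapp k (vvec hk μ₁ μ₂ i) =
      ((-1) ^ (μ₁ - i) * qq ^ ((μ₁ - i) * (μ₂ - i + 1))) • vvec hk μ₂ μ₁ i := by
  obtain ⟨k, rfl⟩ := Nat.exists_eq_add_of_le' hk
  obtain ⟨a, rfl⟩ := Nat.exists_eq_add_of_le hi₁
  obtain ⟨b, rfl⟩ := Nat.exists_eq_add_of_le hi₂
  have hq := qq_ne_zero
  set u : ℕ → Mmod (k + 2) := fun c => vvec hk (i + (a + b - c)) (i + c) i with hu
  have hmem : ∀ c ≤ a + b, u c ∈ Finsupp.supported (RatFunc ℚ) (RatFunc ℚ)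
      {m | ∑ p, m p = i + a + (i + b)} := by
    intro c hc
    have h := vvec_mem_supported hk (Nat.le_add_right i (a + b - c)) (Nat.le_add_right i c)
    rwa [show i + (a + b - c) + (i + c) = i + a + (i + b) by omega] at h
  have hE : ∀ c ≤ a + b, Eop (k + 2) (u c) = qint c • u (c - 1) := by
    intro c hc
    rw [hu, Eop_vvec hk (Nat.le_add_right _ _) (Nat.le_add_right _ _), Nat.add_sub_cancel_left]
    rcases Nat.eq_zero_or_pos c with rfl | h0
    · simp [qint_zero]
    · rw [show i + (a + b - c) + 1 = i + (a + b - (c - 1)) by omega,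
        show i + c - 1 = i + (c - 1) by omega]
  have hF : ∀ c ≤ a + b, (-Fop (k + 2)) (u c) = (-qint (a + b - c)) • u (c + 1) := by
    intro c hc
    rw [LinearMap.neg_apply, neg_smul, hu,
      Fop_vvec hk (Nat.le_add_right _ _) (Nat.le_add_right _ _), Nat.add_sub_cancel_left]
    rcases Nat.eq_zero_or_pos (a + b - c) with h | h
    · simp [h, qint_zero]
    · rw [show i + (a + b - c) - 1 = i + (a + b - (c + 1)) by omega, add_assoc]
  have hH : ∀ (f : ℤ → ℤ), ∀ c ≤ a + b,
      qHop (k + 2) f (u c) = qq ^ f (((a + b : ℕ) : ℤ) - 2 * c) • u c := by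
    intro f c hc
    rw [hu, qHop_vvec hk f (Nat.le_add_right _ _) (Nat.le_add_right _ _)]
    congr 3
    push_cast [Nat.cast_sub hc]
    ring
  have hE₁ : ∀ c ≤ a + b, (qq • (Eop (k + 2) ∘ₗ qHop (k + 2) id)) (u c) =
      (qq ^ (1 * (((a + b : ℕ) : ℤ) - 2 * c + 1)) * qint c) • u (c - 1) := by
    intro c hc
    rw [LinearMap.smul_apply, LinearMap.comp_apply, hH _ c hc, map_smul, hE c hc, smul_smul,
      smul_smul, one_mul, zpow_add_one₀ hq, id]
    congr 1
    ring
  have hE₂ : ∀ c ≤ a + b, (qq⁻¹ • (Eop (k + 2) ∘ₗ qHop (k + 2) (fun w => -w))) (u c) =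
      (qq ^ ((-1) * (((a + b : ℕ) : ℤ) - 2 * c + 1)) * qint c) • u (c - 1) := by
    intro c hc
    rw [LinearMap.smul_apply, LinearMap.comp_apply, hH _ c hc, map_smul, hE c hc, smul_smul,
      smul_smul, neg_one_mul, neg_add, ← sub_eq_add_neg, zpow_sub_one₀ hq]
    congr 1
    ring
  have hub : vvec hk (i + a) (i + b) i = u b := by simp [hu]
  have hua : vvec hk (i + b) (i + a) i = u a := by simp [hu]
  have hN : a + b ≤ i + a + (i + b) := by omega
  have hw : qHop (k + 2) (fun w => w * (w + 1) / 2) (u b) =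
      qq ^ (((a : ℤ) - b) * ((a : ℤ) - b + 1) / 2) • u b := by
    rw [hH _ b (by omega), show ((a + b : ℕ) : ℤ) - 2 * b = a - b by push_cast; ring]
  have hmem₁ : qexpTrunc (i + a + (i + b)) (qq • (Eop (k + 2) ∘ₗ qHop (k + 2) id))
      (qq ^ (((a : ℤ) - b) * ((a : ℤ) - b + 1) / 2) • u b) ∈
      Finsupp.supported (RatFunc ℚ) (RatFunc ℚ) {m | ∑ p, m p = i + a + (i + b)} := by
    rw [map_smul, qexpTrunc_lowering hE₁ hN (by omega)]
    refine Submodule.smul_mem _ _ (Submodule.sum_mem _ fun c hc =>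
      Submodule.smul_mem _ _ (hmem c ?_))
    have : c < b + 1 := Finset.mem_range.1 hc
    omega
  have hmem₂ : qexpTrunc (i + a + (i + b)) (-Fop (k + 2))
      (qexpTrunc (i + a + (i + b)) (qq • (Eop (k + 2) ∘ₗ qHop (k + 2) id))
        (qq ^ (((a : ℤ) - b) * ((a : ℤ) - b + 1) / 2) • u b)) ∈
      Finsupp.supported (RatFunc ℚ) (RatFunc ℚ) {m | ∑ p, m p = i + a + (i + b)} := by
    rw [qexpTrunc_raising_lowering hE₁ hF hN rfl]
    refine Submodule.sum_mem _ fun c hc => Submodule.smul_mem _ _ (hmem c ?_)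
    have : c < a + b + 1 := Finset.mem_range.1 hc
    omega
  rw [hub, hua, Sapp, hw, Nat.add_sub_cancel_left, Nat.add_sub_cancel_left,
    qexpApp_eq_qexpTrunc (Submodule.smul_mem _ _ (hmem b (by omega))),
    qexpApp_eq_qexpTrunc hmem₁, qexpApp_eq_qexpTrunc hmem₂,
    weyl_on_weightString hE₁ hF hE₂ hN rfl]
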